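/- Let k ≥ 2 and q ≥ 2 be integers with q dividing k, and let ℓ ≥ k be an integer. Then (1/k^ℓ)·Σ_{j=0}^{q-1} C(ℓ,j)·(k/q)^j·(k - k/q)^{ℓ-j} ≤ e^{-ℓ/q}·(2ℓ/q)^q. In particular, the probability that a uniformly random sequence of length ℓ over {0,1,...,k-1} contains no jump subsequence of length q (with respect to the partition of {0,...,k-1} into q consecutive blocks of size k/q) is at most e^{-ℓ/q}·(2ℓ/q)^q. -/

import Mathlib

/-- With `{0,…,k-1}` partitioned into `q` consecutive blocks of size `k/q`
(block `B h = {h·(k/q), …, (h+1)·(k/q) - 1}`), the sequence `r : Fin ℓ → Fin k`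
contains a jump subsequence of length `j`: indices `i 0 < i 1 < … < i (j-1)`
with `r (i h) ∈ B h` for every `h`. -/
def HasJumpSub {ℓ k : ℕ} (q : ℕ) (r : Fin ℓ → Fin k) (j : ℕ) : Prop :=
  ∃ i : Fin j → Fin ℓ, StrictMono i ∧
    ∀ h : Fin j, (h : ℕ) * (k / q) ≤ (r (i h) : ℕ) ∧
      (r (i h) : ℕ) < ((h : ℕ) + 1) * (k / q)

/-- Pascal-type recursion for the partial sums of the binomial expansion. -/
theorem sum_range_choose_mul_pow_succ (b c ℓ m : ℕ) :
    ∑ j ∈ Finset.range (m + 1), (ℓ + 1).choose j * b ^ j * c ^ (ℓ + 1 - j) =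
      b * ∑ j ∈ Finset.range m, ℓ.choose j * b ^ j * c ^ (ℓ - j) +
        c * ∑ j ∈ Finset.range (m + 1), ℓ.choose j * b ^ j * c ^ (ℓ - j) := by
  rw [Finset.sum_range_succ', Finset.sum_range_succ' (fun j => ℓ.choose j * b ^ j * c ^ (ℓ - j)),
    mul_add, Finset.mul_sum, Finset.mul_sum, ← add_assoc, ← Finset.sum_add_distrib]
  congr 1
  · refine Finset.sum_congr rfl fun j _ => ?_
    rw [Nat.choose_succ_succ, Nat.add_sub_add_right]
    rcases Nat.lt_or_ge j ℓ with h | h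
    · obtain ⟨d, rfl⟩ := Nat.exists_eq_add_of_lt h
      rw [show j + d + 1 - j = d + 1 by omega, show j + d + 1 - (j + 1) = d by omega]
      ring
    · rw [Nat.choose_eq_zero_of_lt (show ℓ < j + 1 by omega)]
      ring
  · simp [pow_succ, mul_comm]

open Classical in
/-- Words of length `ℓ` without a subsequence whose letters lie in `S 0, …, S (m - 1)` in turn,
where each of these sets has `b` elements. -/
theorem card_filter_not_exists_strictMono_le {α : Type*} [Fintype α] (b ℓ m : ℕ)
    (S : ℕ → Finset α) (hS : ∀ h < m, (S h).card = b) :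
    (Finset.univ.filter fun r : Fin ℓ → α =>
        ¬ ∃ i : Fin m → Fin ℓ, StrictMono i ∧ ∀ h : Fin m, r (i h) ∈ S h).card ≤
      ∑ j ∈ Finset.range m, ℓ.choose j * b ^ j * (Fintype.card α - b) ^ (ℓ - j) := by
  induction ℓ generalizing m S with
  | zero =>
    cases m with
    | zero => simp [Subsingleton.strictMono]
    | succ m =>
      rw [Finset.sum_range_succ']
      exact (Finset.card_le_univ _).trans (by simp)
  | succ ℓ ih =>
    cases m with
    | zero => simp [Subsingleton.strictMono]
    | succ m =>
      rw [sum_range_choose_mul_pow_succ]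
      have h₁ := ih m (fun h => S (h + 1)) fun h hh => hS (h + 1) (by omega)
      have h₂ := ih (m + 1) S hS
      set T₁ := Finset.univ.filter fun r : Fin ℓ → α =>
        ¬ ∃ i : Fin m → Fin ℓ, StrictMono i ∧ ∀ h : Fin m, r (i h) ∈ S (h + 1) with hT₁
      set T₂ := Finset.univ.filter fun r : Fin ℓ → α =>
        ¬ ∃ i : Fin (m + 1) → Fin ℓ, StrictMono i ∧ ∀ h : Fin (m + 1), r (i h) ∈ S h with hT₂
      let f : α × (Fin ℓ → α) → Fin (ℓ + 1) → α := fun p => Fin.cons p.1 p.2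
      have hsub : (Finset.univ.filter fun r : Fin (ℓ + 1) → α =>
          ¬ ∃ i : Fin (m + 1) → Fin (ℓ + 1), StrictMono i ∧ ∀ h : Fin (m + 1), r (i h) ∈ S h) ⊆
          (S 0 ×ˢ T₁).image f ∪ ((S 0)ᶜ ×ˢ T₂).image f := by
        intro r hr
        rw [Finset.mem_filter] at hr
        replace hr := hr.2
        have hcons : f (r 0, fun x => r x.succ) = r := Fin.cons_self_tail r
        rw [Finset.mem_union]
        by_cases h0 : r 0 ∈ S 0
        · refine Or.inl (Finset.mem_image.2 ⟨(r 0, fun x => r x.succ), ?_, hcons⟩)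
          rw [Finset.mem_product, hT₁, Finset.mem_filter]
          refine ⟨h0, Finset.mem_univ _, fun ⟨i, hi, hmem⟩ => hr ?_⟩
          refine ⟨Fin.cons 0 fun h => (i h).succ, ?_, fun h => ?_⟩
          · intro x y hxy
            cases y using Fin.cases with
            | zero => exact absurd hxy (Fin.not_lt_zero x)
            | succ y =>
              cases x using Fin.cases with
              | zero => simp
              | succ x => simpa using hi (Fin.succ_lt_succ_iff.1 hxy)
          · cases h using Fin.cases with
            | zero => simpa using h0
            | succ h => simpa using hmem h
        · refine Or.inr (Finset.mem_image.2 ⟨(r 0, fun x => r x.succ), ?_, hcons⟩)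
          rw [Finset.mem_product, hT₂, Finset.mem_filter]
          refine ⟨Finset.mem_compl.2 h0, Finset.mem_univ _, fun ⟨i, hi, hmem⟩ => hr ?_⟩
          exact ⟨fun h => (i h).succ, fun x y hxy => Fin.succ_lt_succ_iff.2 (hi hxy), hmem⟩
      calc _ ≤ _ := Finset.card_le_card hsub
        _ ≤ _ := Finset.card_union_le _ _
        _ ≤ (S 0 ×ˢ T₁).card + ((S 0)ᶜ ×ˢ T₂).card :=
            Nat.add_le_add Finset.card_image_le Finset.card_image_le
        _ ≤ _ := by
            rw [Finset.card_product, Finset.card_product, Finset.card_compl, hS 0 (by omega)]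
            exact Nat.add_le_add (Nat.mul_le_mul_left _ h₁) (Nat.mul_le_mul_left _ h₂)

theorem card_filter_fin_block {k b h : ℕ} (hb : (h + 1) * b ≤ k) :
    (Finset.univ.filter fun x : Fin k => h * b ≤ (x : ℕ) ∧ (x : ℕ) < (h + 1) * b).card = b := by
  have himage : (Finset.univ.filter fun x : Fin k =>
      h * b ≤ (x : ℕ) ∧ (x : ℕ) < (h + 1) * b).map Fin.valEmbedding =
      Finset.Ico (h * b) ((h + 1) * b) := by
    ext x
    simp only [Finset.mem_map, Finset.mem_filter, Finset.mem_univ, true_and,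
      Fin.valEmbedding_apply, Finset.mem_Ico]
    exact ⟨fun ⟨y, hy, hyx⟩ => hyx ▸ hy, fun hx => ⟨⟨x, by omega⟩, hx, rfl⟩⟩
  rw [← Finset.card_map Fin.valEmbedding, himage, Nat.card_Ico, add_mul, one_mul,
    Nat.add_sub_cancel_left]

theorem card_not_hasJumpSub_le {k q : ℕ} (ℓ : ℕ) (hdvd : q ∣ k) :
    Nat.card {r : Fin ℓ → Fin k // ¬ HasJumpSub q r q} ≤
      ∑ j ∈ Finset.range q, ℓ.choose j * (k / q) ^ j * (k - k / q) ^ (ℓ - j) := by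
  classical
  have key := card_filter_not_exists_strictMono_le (k / q) ℓ q
    (fun h => Finset.univ.filter fun x : Fin k =>
      h * (k / q) ≤ (x : ℕ) ∧ (x : ℕ) < (h + 1) * (k / q))
    fun h hh => card_filter_fin_block <|
      (Nat.mul_le_mul_right _ hh).trans (Nat.mul_div_cancel' hdvd).le
  rw [Nat.card_eq_fintype_card, Fintype.card_subtype]
  simpa [HasJumpSub] using key

/-- A termwise estimate for the lower tail of the binomial distribution with parameters
`ℓ` and `1 / q`. -/
theorem choose_mul_inv_pow_mul_one_sub_inv_pow_le {q ℓ j : ℕ} (hq : 2 ≤ q) (hℓ : q ≤ ℓ)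
    (hj : j < q) :
    (ℓ.choose j : ℝ) * (1 / (q : ℝ)) ^ j * (1 - 1 / (q : ℝ)) ^ (ℓ - j) ≤
      Real.exp (-(ℓ : ℝ) / q) * ((ℓ : ℝ) / q) ^ q * (q.choose j : ℝ) := by
  have hq2 : (2 : ℝ) ≤ q := by exact_mod_cast hq
  have hq0 : (0 : ℝ) < q := by linarith
  have hmean : 1 ≤ (ℓ : ℝ) / q := by
    rw [one_le_div hq0]
    exact_mod_cast hℓ
  have hinv : 1 / (q : ℝ) ≤ 1 / 2 := one_div_le_one_div_of_le two_pos hq2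
  have hexp : Real.exp (1 / q) ≤ 2 := by
    refine (Real.le_log_iff_exp_le two_pos).1 ?_
    linarith [Real.log_two_gt_d9]
  have hpow : (1 - 1 / (q : ℝ)) ^ (ℓ - j) ≤ Real.exp (-(ℓ : ℝ) / q) * 2 ^ j := by
    calc (1 - 1 / (q : ℝ)) ^ (ℓ - j) ≤ Real.exp (-(1 / q)) ^ (ℓ - j) :=
          pow_le_pow_left₀ (by linarith) (Real.one_sub_le_exp_neg _) _
      _ = Real.exp (-(ℓ : ℝ) / q) * Real.exp (1 / q) ^ j := by
          rw [← Real.exp_nat_mul, ← Real.exp_nat_mul, ← Real.exp_add, Nat.cast_sub (by omega)]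
          congr 1
          ring
      _ ≤ _ := by gcongr
  have hdesc : (2 : ℝ) ^ j / j.factorial ≤ q.choose j := by
    rw [div_le_iff₀ (by positivity)]
    have h₁ : 2 ^ j ≤ q.choose j * j.factorial := by
      rw [mul_comm, ← Nat.descFactorial_eq_factorial_mul_choose]
      exact (Nat.pow_le_pow_left (by omega) j).trans (Nat.pow_sub_le_descFactorial q j)
    exact_mod_cast h₁
  have hbase : 0 ≤ 1 - 1 / (q : ℝ) := by linarith
  calc (ℓ.choose j : ℝ) * (1 / (q : ℝ)) ^ j * (1 - 1 / (q : ℝ)) ^ (ℓ - j)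
      ≤ ((ℓ : ℝ) ^ j / j.factorial) * (1 / (q : ℝ)) ^ j *
          (Real.exp (-(ℓ : ℝ) / q) * 2 ^ j) := by
        gcongr
        exact Nat.choose_le_pow_div j ℓ
    _ = Real.exp (-(ℓ : ℝ) / q) * ((ℓ : ℝ) / q) ^ j * (2 ^ j / j.factorial) := by
        rw [div_pow, div_pow, one_pow]
        ring
    _ ≤ _ := by gcongr

theorem sum_range_choose_mul_pow_div_le {k q ℓ : ℕ} (hk : 0 < k) (hq : 2 ≤ q)
    (hdvd : q ∣ k) (hℓ : k ≤ ℓ) :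
    (1 / (k : ℝ) ^ ℓ) *
        (∑ j ∈ Finset.range q,
          (ℓ.choose j : ℝ) * ((k / q : ℕ) : ℝ) ^ j * ((k - k / q : ℕ) : ℝ) ^ (ℓ - j)) ≤
      Real.exp (-(ℓ : ℝ) / (q : ℝ)) * (2 * (ℓ : ℝ) / (q : ℝ)) ^ q := by
  have hqk : q ≤ k := Nat.le_of_dvd hk hdvd
  have hq0 : (q : ℝ) ≠ 0 := by positivity
  have hk0 : (k : ℝ) ≠ 0 := by positivity
  have hb : ((k / q : ℕ) : ℝ) = k * (1 / q) := by
    rw [Nat.cast_div hdvd hq0]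
    ring
  have hc : ((k - k / q : ℕ) : ℝ) = k * (1 - 1 / q) := by
    rw [Nat.cast_sub (Nat.div_le_self k q), hb]
    ring
  have hsum : ∑ j ∈ Finset.range q, (q.choose j : ℝ) ≤ 2 ^ q := by
    have h := Nat.sum_range_choose q
    rw [Finset.sum_range_succ] at h
    exact_mod_cast Nat.le_of_add_right_le h.le
  calc _ = ∑ j ∈ Finset.range q,
        (ℓ.choose j : ℝ) * (1 / (q : ℝ)) ^ j * (1 - 1 / (q : ℝ)) ^ (ℓ - j) := by
        rw [Finset.mul_sum]
        refine Finset.sum_congr rfl fun j hj => ?_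
        have hjℓ : j ≤ ℓ := by
          have := Finset.mem_range.1 hj
          omega
        rw [hb, hc, mul_pow, mul_pow, ← pow_mul_pow_sub (k : ℝ) hjℓ]
        field_simp
    _ ≤ ∑ j ∈ Finset.range q,
        Real.exp (-(ℓ : ℝ) / q) * ((ℓ : ℝ) / q) ^ q * (q.choose j : ℝ) :=
        Finset.sum_le_sum fun j hj => choose_mul_inv_pow_mul_one_sub_inv_pow_le hq
          (hqk.trans hℓ) (Finset.mem_range.1 hj)
    _ ≤ Real.exp (-(ℓ : ℝ) / q) * ((ℓ : ℝ) / q) ^ q * 2 ^ q := by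
        rw [← Finset.mul_sum]
        gcongr
    _ = _ := by
        rw [mul_div_assoc, mul_pow]
        ring

theorem prob_no_jump_subsequence_le (k q ℓ : ℕ) (hk : 2 ≤ k) (hq : 2 ≤ q)
    (hdvd : q ∣ k) (hℓ : k ≤ ℓ) :
    (1 / (k : ℝ) ^ ℓ) *
        (∑ j ∈ Finset.range q,
          (ℓ.choose j : ℝ) * ((k / q : ℕ) : ℝ) ^ j * ((k - k / q : ℕ) : ℝ) ^ (ℓ - j)) ≤
      Real.exp (-(ℓ : ℝ) / (q : ℝ)) * (2 * (ℓ : ℝ) / (q : ℝ)) ^ q ∧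
    (Nat.card {r : Fin ℓ → Fin k // ¬ HasJumpSub q r q} : ℝ) / (k : ℝ) ^ ℓ ≤
      Real.exp (-(ℓ : ℝ) / (q : ℝ)) * (2 * (ℓ : ℝ) / (q : ℝ)) ^ q := by
  have hbound := sum_range_choose_mul_pow_div_le (by omega : 0 < k) hq hdvd hℓ
  refine ⟨hbound, le_trans ?_ hbound⟩
  rw [div_eq_mul_one_div, mul_comm]
  gcongr
  exact_mod_cast card_not_hasJumpSub_le ℓ hdvd
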